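/- arXiv:math/0409169 — 2 statements merged into one kernel-verified Lean document; each statement's English description precedes it below -/
import Mathlib

section
/- For every ε > 0 and every n ∈ ℕ there is δ > 0 with the following property. Let A be a unital C*-algebra with real rank zero, let T be a set of tracial states on A, let r ∈ A be a projection, and let p₁, p₂, …, pₙ be projections with pₖ ≤ r for all k, such that ‖pⱼ pₖ‖_{2,τ} < δ for all j ≠ k and all τ ∈ T. Then there exist mutually orthogonal projections q₁, q₂, …, qₙ with qₖ ≤ r for all k such that ‖qₖ − pₖ‖_{2,τ} < ε for all k and all τ ∈ T. -/
open ComplexOrder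

/-- A projection in a C*-algebra: a self-adjoint idempotent. -/
def IsProjection {A : Type*} [Mul A] [Star A] (p : A) : Prop :=
  star p = p ∧ p * p = p

/-- A unital C*-algebra has real rank zero if the invertible self-adjoint elements are dense
in the self-adjoint elements. -/
def RealRankZero (A : Type*) [NormedRing A] [StarRing A] : Prop :=
  ∀ a : A, IsSelfAdjoint a → ∀ ε : ℝ, 0 < ε →
    ∃ b : A, IsSelfAdjoint b ∧ IsUnit b ∧ ‖a - b‖ < ε

/-- A tracial state on a unital C*-algebra: a unital positive linear functional with the
trace property. -/
def IsTracialState {A : Type*} [Ring A] [PartialOrder A] [StarRing A] [Module ℂ A]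
    (τ : A →ₗ[ℂ] ℂ) : Prop :=
  τ 1 = 1 ∧ (∀ a : A, 0 ≤ a → 0 ≤ τ a) ∧ ∀ a b : A, τ (a * b) = τ (b * a)

/-- The trace seminorm `‖x‖_{2,τ} = τ(x* x)^(1/2)` associated with a tracial state `τ`. -/
noncomputable def traceSeminorm {A : Type*} [NonUnitalRing A] [StarRing A] [Module ℂ A]
    (τ : A →ₗ[ℂ] ℂ) (x : A) : ℝ :=
  Real.sqrt (τ (star x * x)).re

section TraceSeminorm

variable {A : Type*} [CStarAlgebra A] {τ : A →ₗ[ℂ] ℂ}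

theorem traceSeminorm_nonneg (τ : A →ₗ[ℂ] ℂ) (x : A) : 0 ≤ traceSeminorm τ x :=
  Real.sqrt_nonneg _

theorem IsTracialState.traceSeminorm_star [PartialOrder A] (h : IsTracialState τ) (x : A) :
    traceSeminorm τ (star x) = traceSeminorm τ x := by
  simp only [traceSeminorm, star_star, h.2.2 x (star x)]

variable [PartialOrder A] [StarOrderedRing A]

theorem IsTracialState.traceSeminorm_eq_norm (h : IsTracialState τ) (x : A) :
    traceSeminorm τ x = ‖(PositiveLinearMap.mk₀ τ h.2.1).toPreGNS x‖ := rfl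

theorem IsTracialState.traceSeminorm_add_le (h : IsTracialState τ) (x y : A) :
    traceSeminorm τ (x + y) ≤ traceSeminorm τ x + traceSeminorm τ y := by
  simp only [h.traceSeminorm_eq_norm, map_add]
  exact norm_add_le _ _

theorem IsTracialState.traceSeminorm_sub_le (h : IsTracialState τ) (x y : A) :
    traceSeminorm τ (x - y) ≤ traceSeminorm τ x + traceSeminorm τ y := by
  simp only [h.traceSeminorm_eq_norm, map_sub]
  exact norm_sub_le _ _

theorem IsTracialState.traceSeminorm_sum_le (h : IsTracialState τ) {ι : Type*} (s : Finset ι)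
    (x : ι → A) : traceSeminorm τ (∑ i ∈ s, x i) ≤ ∑ i ∈ s, traceSeminorm τ (x i) := by
  simp only [h.traceSeminorm_eq_norm, map_sum]
  exact norm_sum_le _ _

theorem IsTracialState.traceSeminorm_mul_le (h : IsTracialState τ) (x y : A) :
    traceSeminorm τ (x * y) ≤ ‖x‖ * traceSeminorm τ y :=
  ((PositiveLinearMap.mk₀ τ h.2.1).leftMulMapPreGNS x).le_of_opNorm_le
    (LinearMap.mkContinuous_norm_le _ (norm_nonneg _) _)
    ((PositiveLinearMap.mk₀ τ h.2.1).toPreGNS y)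

theorem IsTracialState.traceSeminorm_mul_le' (h : IsTracialState τ) (x y : A) :
    traceSeminorm τ (x * y) ≤ traceSeminorm τ x * ‖y‖ := by
  rw [← h.traceSeminorm_star, star_mul, mul_comm]
  simpa only [norm_star, h.traceSeminorm_star] using h.traceSeminorm_mul_le (star y) (star x)

theorem IsTracialState.traceSeminorm_le_norm (h : IsTracialState τ) (x : A) :
    traceSeminorm τ x ≤ ‖x‖ := by
  have h1 : traceSeminorm τ (1 : A) = 1 := by simp [traceSeminorm, h.1]
  simpa [h1] using h.traceSeminorm_mul_le x 1

end TraceSeminorm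

section Projection

variable {A : Type*} [CStarAlgebra A]

theorem IsProjection.one_sub {q : A} (hq : IsProjection q) : IsProjection (1 - q) := by
  refine ⟨by rw [star_sub, star_one, hq.1], ?_⟩
  linear_combination (norm := noncomm_ring) hq.2

theorem IsProjection.norm_le_one {q : A} (hq : IsProjection q) : ‖q‖ ≤ 1 :=
  IsStarProjection.norm_le q ⟨hq.2, hq.1⟩

theorem IsProjection.le_of_mul_eq [PartialOrder A] [StarOrderedRing A] {p q : A}
    (hp : IsProjection p) (hq : IsProjection q) (h : q * p = p) : p ≤ q :=
  IsStarProjection.le_of_mul_eq_right ⟨hp.2, hp.1⟩ ⟨hq.2, hq.1⟩ h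

theorem IsProjection.mul_eq_of_le [PartialOrder A] [StarOrderedRing A] {p q : A}
    (hp : IsProjection p) (hq : IsProjection q) (h : p ≤ q) : q * p = p :=
  (IsStarProjection.le_iff_mul_eq_right ⟨hp.2, hp.1⟩ ⟨hq.2, hq.1⟩).1 h

/-- The positive spectral projection `e` of a self-adjoint invertible element `d`, together with
the factorizations of `e` and of `e - (d + 1/2)` provided by the functional calculus. -/
theorem exists_projection_of_isUnit {d : A} (hd : IsSelfAdjoint d) (hu : IsUnit d) :
    ∃ e G K : A, IsProjection e ∧ ‖G‖ ≤ 2 ∧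
      e - (d + algebraMap ℝ A (1 / 2)) = G * (algebraMap ℝ A (1 / 4) - d * d) ∧
      e = K * (d + 1) := by
  have h0 : ∀ t ∈ spectrum ℝ d, t ≠ 0 := fun t ht h ↦ spectrum.zero_notMem ℝ hu (h ▸ ht)
  let χ : ℝ → ℝ := fun t ↦ if 0 < t then 1 else 0
  let G : ℝ → ℝ := fun t ↦ if 0 < t then (1 / 2 + t)⁻¹ else -(1 / 2 - t)⁻¹
  let K : ℝ → ℝ := fun t ↦ if 0 < t then (t + 1)⁻¹ else 0
  have cont : ∀ f g : ℝ → ℝ, (∀ t, 0 < t → ContinuousAt f t) → (∀ t, t < 0 → ContinuousAt g t) →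
      ContinuousOn (fun t ↦ if 0 < t then f t else g t) (spectrum ℝ d) := by
    intro f g hf hg t ht
    refine ContinuousAt.continuousWithinAt ?_
    rcases lt_or_gt_of_ne (h0 t ht) with h | h
    · refine (hg t h).congr ?_
      filter_upwards [eventually_lt_nhds h] with s hs
      rw [if_neg hs.not_gt]
    · refine (hf t h).congr ?_
      filter_upwards [eventually_gt_nhds h] with s hs
      rw [if_pos hs]
  have hχ : ContinuousOn χ (spectrum ℝ d) :=
    cont _ _ (fun _ _ ↦ continuousAt_const) (fun _ _ ↦ continuousAt_const)
  have hG : ContinuousOn G (spectrum ℝ d) := by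
    refine cont _ _ (fun t ht ↦ ?_) (fun t ht ↦ ?_)
    · exact (continuousAt_const.add continuousAt_id).inv₀ (by dsimp; linarith)
    · exact ((continuousAt_const.sub continuousAt_id).inv₀ (by dsimp; linarith)).neg
  have hK : ContinuousOn K (spectrum ℝ d) := by
    refine cont _ _ (fun t ht ↦ ?_) (fun _ _ ↦ continuousAt_const)
    exact (continuousAt_id.add continuousAt_const).inv₀ (by dsimp; linarith)
  refine ⟨cfc χ d, cfc G d, cfc K d, ⟨cfc_predicate χ d, ?_⟩, ?_, ?_, ?_⟩
  · rw [← cfc_mul χ χ d]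
    refine cfc_congr fun t _ ↦ ?_
    simp only [χ]; split_ifs <;> simp
  · refine norm_cfc_le (by norm_num) fun t _ ↦ ?_
    simp only [G]
    split_ifs with h
    · rw [norm_inv, Real.norm_of_nonneg (by linarith)]
      exact inv_le_of_inv_le₀ (by norm_num) (by linarith)
    · rw [norm_neg, norm_inv, Real.norm_of_nonneg (by linarith)]
      exact inv_le_of_inv_le₀ (by norm_num) (by linarith)
  · have e1 : d + algebraMap ℝ A (1 / 2) = cfc (fun t : ℝ ↦ t + 1 / 2) d := by
      rw [cfc_add_const (1 / 2 : ℝ) (fun t ↦ t) d, cfc_id' ℝ d]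
    have e2 : algebraMap ℝ A (1 / 4) - d * d = cfc (fun t : ℝ ↦ 1 / 4 - t * t) d := by
      rw [cfc_sub (fun _ : ℝ ↦ (1 / 4 : ℝ)) (fun t : ℝ ↦ t * t) d, cfc_const (1 / 4 : ℝ) d,
        cfc_mul (fun t : ℝ ↦ t) (fun t : ℝ ↦ t) d, cfc_id' ℝ d]
    rw [e1, e2, ← cfc_sub χ _ d, ← cfc_mul G _ d]
    refine cfc_congr fun t ht ↦ ?_
    have := h0 t ht
    simp only [χ, G]
    split_ifs with h
    · have : 1 / 2 + t ≠ 0 := by linarith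
      field_simp
      ring
    · have h2 : 1 / 2 - t ≠ 0 := by linarith
      have h3 : 1 / 4 - t * t = (1 / 2 - t) * (t + 1 / 2) := by ring
      rw [h3, neg_mul, inv_mul_cancel_left₀ h2, zero_sub]
  · have e1 : d + 1 = cfc (fun t : ℝ ↦ t + 1) d := by
      rw [cfc_add_const (1 : ℝ) (fun t ↦ t) d, cfc_id' ℝ d, map_one]
    rw [e1, ← cfc_mul K _ d]
    refine cfc_congr fun t _ ↦ ?_
    simp only [χ, K]
    split_ifs with h
    · exact (inv_mul_cancel₀ (by linarith)).symm
    · simp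

/-- Corners of a C*-algebra of real rank zero have real rank zero. -/
theorem RealRankZero.exists_corner_approx (hA : RealRankZero A) {q a : A} (hq : IsProjection q)
    (ha : IsSelfAdjoint a) (hqa : q * a = a) {η : ℝ} (hη : 0 < η) :
    ∃ c : A, IsSelfAdjoint c ∧ q * c = c ∧ c * q = c ∧ IsUnit (c - (1 - q)) ∧ ‖c - a‖ ≤ η := by
  obtain ⟨g, hg⟩ : ∃ g, g = 1 - q := ⟨_, rfl⟩
  have hgp : IsProjection g := hg ▸ hq.one_sub
  have hq1 := hq.norm_le_one
  have hg1 := hgp.norm_le_one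
  have haq : a * q = a := by simpa [ha.star_eq, hq.1] using congrArg star hqa
  have hqg : q * g = 0 := by
    rw [hg]; linear_combination (norm := noncomm_ring) -hq.2
  have hgq : g * q = 0 := by
    rw [hg]; linear_combination (norm := noncomm_ring) -hq.2
  have hsum : q + g = 1 := by rw [hg]; abel
  have hag : a * g = 0 := by rw [hg, mul_sub, mul_one, haq, sub_self]
  have hga : g * a = 0 := by rw [hg, sub_mul, one_mul, hqa, sub_self]
  let ρ := min (1 / 2) (η / 2)
  have hρ : 0 < ρ := by positivity
  have hρ1 : ρ ≤ 1 / 2 := min_le_left _ _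
  have hρ2 : ρ ≤ η / 2 := min_le_right _ _
  have hsa : IsSelfAdjoint (a + g) := ha.add hgp.1
  obtain ⟨b, hb, hbu, hab⟩ := hA (a + g) hsa ρ hρ
  rw [norm_sub_rev] at hab
  have comp : ∀ x y z : A, ‖x‖ ≤ 1 → ‖z‖ ≤ 1 → ‖x * y * z‖ ≤ ‖y‖ := fun x y z hx hz ↦
    calc ‖x * y * z‖ ≤ ‖x‖ * ‖y‖ * ‖z‖ := norm_mul₃_le
      _ ≤ 1 * ‖y‖ * 1 := by gcongr
      _ = ‖y‖ := by ring
  have hgbg : ‖g * b * g - g‖ ≤ ρ := by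
    refine le_trans (le_of_eq ?_) ((comp g (b - (a + g)) g hg1 hg1).trans hab.le)
    congr 1
    linear_combination (norm := noncomm_ring) hga * g + hgp.2 * g + hgp.2
  have hqbq : ‖q * b * q - a‖ ≤ ρ := by
    refine le_trans (le_of_eq ?_) ((comp q (b - (a + g)) q hq1 hq1).trans hab.le)
    congr 1
    linear_combination (norm := noncomm_ring) hqa * q + haq + hqg * q
  have hqbg : ‖q * b * g‖ ≤ ρ := by
    refine le_trans (le_of_eq ?_) ((comp q (b - (a + g)) g hq1 hg1).trans hab.le)
    congr 1
    linear_combination (norm := noncomm_ring) q * hag + hqg * g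
  have hgbq : ‖g * b * q‖ ≤ ρ := by
    have := norm_star (q * b * g)
    simp only [star_mul, hq.1, hgp.1, hb.star_eq, ← mul_assoc] at this
    rwa [this]
  have hone : ‖(1 : A)‖ ≤ 1 := IsProjection.norm_le_one ⟨star_one _, mul_one _⟩
  obtain ⟨u, hu⟩ : IsUnit (q + g * b * g) := by
    have h : ‖g - g * b * g‖ < 1 := by rw [norm_sub_rev]; linarith
    have := (Units.oneSub _ h).isUnit
    rwa [Units.val_oneSub, ← hsum, add_sub_assoc, sub_sub_cancel] at this
  obtain ⟨v, hv⟩ : ∃ v : A, v = ((u⁻¹ : Aˣ) : A) := ⟨_, rfl⟩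
  have huv : (q + g * b * g) * v = 1 := by rw [hv, ← hu, Units.mul_inv]
  have hvu : v * (q + g * b * g) = 1 := by rw [hv, ← hu, Units.inv_mul]
  have hvs : star v = v := by
    have h : star v * (q + g * b * g) = 1 := by
      simpa [hq.1, hgp.1, hb.star_eq, ← mul_assoc] using congrArg star huv
    calc star v = star v * ((q + g * b * g) * v) := by rw [huv, mul_one]
      _ = v := by rw [← mul_assoc, h, one_mul]
  have hvn : ‖v‖ ≤ 2 := by
    have h : v = 1 - (g * b * g - g) * v := by
      linear_combination (norm := noncomm_ring) huv - hsum * v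
    have h2 : ‖v‖ ≤ 1 + 1 / 2 * ‖v‖ := by
      calc ‖v‖ = ‖1 - (g * b * g - g) * v‖ := congrArg _ h
        _ ≤ ‖(1 : A)‖ + ‖g * b * g - g‖ * ‖v‖ := 
          (norm_sub_le _ _).trans (by gcongr; exact norm_mul_le _ _)
        _ ≤ 1 + 1 / 2 * ‖v‖ := by gcongr; linarith
    linarith
  have hvq : v * q = q := by
    linear_combination (norm := noncomm_ring) hvu * q - v * hq.2 - v * g * b * hgq
  have hqv : q * v = q := by
    linear_combination (norm := noncomm_ring) q * huv - hq.2 * v - hqg * b * g * v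
  obtain ⟨w, hw⟩ : ∃ w, w = v - q := ⟨_, rfl⟩
  have hws : star w = w := by rw [hw, star_sub, hvs, hq.1]
  have hwg : w * g = w := by
    rw [hw, hg]; linear_combination (norm := noncomm_ring) hq.2 - hvq
  have hgw : g * w = w := by
    rw [hw, hg]; linear_combination (norm := noncomm_ring) hq.2 - hqv
  have hwn : ‖w‖ ≤ 2 := by
    have h : w = 1 * v * g := by
      rw [hw, hg]; linear_combination (norm := noncomm_ring) hvq
    rw [h]
    exact (comp 1 v g hone hg1).trans hvn
  have hwbg : w * b * g = g := by
    have h : w * g * b * g = g := by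
      rw [hw]
      linear_combination (norm := noncomm_ring) hvu - hvq - hqg * b * g - hsum
    rwa [hwg] at h
  have hgbw : g * b * w = g := by
    simpa [hgp.1, hb.star_eq, hws, ← mul_assoc] using congrArg star hwbg
  refine ⟨q * b * q - q * b * w * b * q, ?_, ?_, ?_, ?_, ?_⟩
  · simp [IsSelfAdjoint, hq.1, hb.star_eq, hws, ← mul_assoc]
  · linear_combination (norm := noncomm_ring) hq.2 * b * q - hq.2 * b * w * b * q
  · linear_combination (norm := noncomm_ring) q * b * hq.2 - q * b * w * b * hq.2
  · have hwq : w * q = 0 := by rw [hw, sub_mul, hvq, hq.2, sub_self]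
    have hqw : q * w = 0 := by rw [hw, mul_sub, hqv, hq.2, sub_self]
    have hS : IsUnit (1 - q * b * w) := by
      refine ⟨⟨1 - q * b * w, 1 + q * b * w, ?_, ?_⟩, rfl⟩
      · linear_combination (norm := noncomm_ring) -(q * b) * hwq * (b * w)
      · linear_combination (norm := noncomm_ring) -(q * b) * hwq * (b * w)
    have hS' : IsUnit (1 - w * b * q) := by
      simpa [hq.1, hb.star_eq, hws, ← mul_assoc] using hS.star
    have hJ : IsUnit (q - g) := by
      refine ⟨⟨q - g, q - g, ?_, ?_⟩, rfl⟩ <;>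
      linear_combination (norm := noncomm_ring) hq.2 + hgp.2 - hqg - hgq + hsum
    have hV : IsUnit v := hv ▸ (u⁻¹).isUnit
    have hwbw : w * b * w = w := by
      linear_combination (norm := noncomm_ring) hwbg * w - w * b * hgw + hgw
    have hb4 : b = q * b * q + q * b * g + g * b * q + g * b * g := by
      linear_combination (norm := noncomm_ring) -hsum * b * (q + g) - b * hsum
    have h1 : q * b * w * b = q * b * w * b * q + q * b * g := by
      linear_combination (norm := noncomm_ring) q * b * hwbg - q * b * w * b * hsum
    have h2 : b * w * b * q = q * b * w * b * q + g * b * q := by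
      linear_combination (norm := noncomm_ring) hgbw * b * q - hsum * b * w * b * q
    have m1 : (1 - q * b * w) * b * (1 - w * b * q) =
        q * b * q - q * b * w * b * q + g * b * g := by
      linear_combination (norm := noncomm_ring) hb4 - h1 - h2 + q * b * hwbw * b * q
    have m2 : (q * b * q - q * b * w * b * q + g * b * g) * v =
        q * b * q - q * b * w * b * q + g := by
      have hv' : v = w + q := by rw [hw, sub_add_cancel]
      rw [hv']
      linear_combination (norm := noncomm_ring) (q * b - q * b * w * b) * (hqw + hq.2) +
        g * b * hgw + g * b * hgq + hgbw
    have m3 : (q * b * q - q * b * w * b * q + g) * (q - g) =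
        q * b * q - q * b * w * b * q - g := by
      linear_combination (norm := noncomm_ring) (q * b - q * b * w * b) * (hq.2 - hqg) +
        hgq - hgp.2
    rw [← hg, ← m3, ← m2, ← m1]
    exact (((hS.mul hbu).mul hS').mul hV).mul hJ
  · have e : q * b * q - q * b * w * b * q - a =
        (q * b * q - a) - (q * b * g) * w * (g * b * q) := by
      linear_combination (norm := noncomm_ring)
        q * b * hgw * b * q + q * b * g * hwg * b * q
    rw [e]
    calc _ ≤ ‖q * b * q - a‖ + ‖q * b * g‖ * ‖w‖ * ‖g * b * q‖ :=
          (norm_sub_le _ _).trans (by gcongr; exact norm_mul₃_le)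
      _ ≤ ρ + ρ * 2 * (1 / 2) := by gcongr; linarith
      _ ≤ η := by linarith

/-- A finite sum of mutually orthogonal projections below `r` leaves a projection `r - ∑ k, q k`
that is below `r` and orthogonal to every summand. -/
theorem IsProjection.sub_sum {ι : Type*} [Fintype ι] {r : A}
    {q : ι → A} (hr : IsProjection r) (hq : ∀ k, IsProjection (q k))
    (hqq : ∀ j k, j ≠ k → q j * q k = 0) (hrq : ∀ k, r * q k = q k) :
    IsProjection (r - ∑ k, q k) ∧ r * (r - ∑ k, q k) = r - ∑ k, q k ∧
      ∀ k, (r - ∑ j, q j) * q k = 0 := by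
  classical
  have hrs : r * ∑ k, q k = ∑ k, q k := by simp only [Finset.mul_sum, hrq]
  have hs : star (∑ k, q k) = ∑ k, q k := by simp only [star_sum, (hq _).1]
  have hsr : (∑ k, q k) * r = ∑ k, q k := by
    simpa only [star_mul, hs, hr.1] using congrArg star hrs
  have hsq : ∀ k, (∑ j, q j) * q k = q k := fun k ↦ by
    rw [Finset.sum_mul, Finset.sum_eq_single k (fun j _ h ↦ hqq j k h) (by simp), (hq k).2]
  have hss : (∑ k, q k) * (∑ k, q k) = ∑ k, q k := by
    rw [Finset.mul_sum]
    exact Finset.sum_congr rfl fun k _ ↦ hsq k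
  refine ⟨⟨by rw [star_sub, hr.1, hs], ?_⟩, by rw [mul_sub, hr.2, hrs], fun k ↦ by
    rw [sub_mul, hrq, hsq, sub_self]⟩
  rw [sub_mul, mul_sub, mul_sub, hr.2, hrs, hsr, hss, sub_self, sub_zero]

end Projection

section Approximation

variable {A : Type*} [CStarAlgebra A] [PartialOrder A] [StarOrderedRing A]

/-- In a C*-algebra of real rank zero, a projection `p` is close in trace seminorm to a projection
below `q`, up to the size of `(1 - q) * p`. -/
theorem RealRankZero.exists_projection_mul_eq (hA : RealRankZero A) {p q : A}
    (hp : IsProjection p) (hq : IsProjection q) {η : ℝ} (hη : 0 < η) (hη1 : η ≤ 1) :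
    ∃ e : A, IsProjection e ∧ q * e = e ∧ ∀ τ : A →ₗ[ℂ] ℂ, IsTracialState τ →
      traceSeminorm τ (e - p) ≤ 14 * traceSeminorm τ ((1 - q) * p) + 9 * η := by
  obtain ⟨g, hg⟩ : ∃ g, g = 1 - q := ⟨_, rfl⟩
  have hgp : IsProjection g := hg ▸ hq.one_sub
  have hq1 := hq.norm_le_one
  have hp1 := hp.norm_le_one
  have hgq : g * q = 0 := by
    rw [hg]; linear_combination (norm := noncomm_ring) -hq.2
  obtain ⟨H, hH⟩ : ∃ H, H = algebraMap ℝ A (1 / 2) := ⟨_, rfl⟩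
  have hHs : star H = H := by rw [hH]; exact (IsSelfAdjoint.all (1 / 2 : ℝ)).algebraMap A
  have hHc : ∀ z : A, H * z = z * H := fun z ↦ hH ▸ Algebra.commutes _ _
  have hH2 : H + H = 1 := by rw [hH, ← map_add]; norm_num
  have hHH : algebraMap ℝ A (1 / 4) = H * H := by rw [hH, ← map_mul]; norm_num
  obtain ⟨x, hx⟩ : ∃ x, x = q * p * q := ⟨_, rfl⟩
  have hxs : star x = x := by simp [hx, hq.1, hp.1, mul_assoc]
  have hqx : q * x = x := by
    rw [hx]; linear_combination (norm := noncomm_ring) hq.2 * p * q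
  have hx1 : ‖x‖ ≤ 1 := by
    calc ‖x‖ ≤ ‖q‖ * ‖p‖ * ‖q‖ := hx ▸ norm_mul₃_le
      _ ≤ 1 * 1 * 1 := by gcongr
      _ = 1 := by norm_num
  obtain ⟨c, hcs, hqc, hcq, hcu, hca⟩ := hA.exists_corner_approx (a := x - H * q) hq
    (by simp [IsSelfAdjoint, hxs, hHs, hq.1, hHc])
    (by linear_combination (norm := noncomm_ring) hqx + hHc q * q - H * hq.2) hη
  rw [← hg] at hcu
  obtain ⟨e, G, K, he, hG, heG, heK⟩ := exists_projection_of_isUnit (hcs.sub hgp.1) hcu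
  rw [← hH, hHH] at heG
  have heg : e * g = 0 := by
    rw [heK, hg]
    linear_combination (norm := noncomm_ring) -K * hq.2 - K * hcq
  have heq : e * q = e := by
    rw [hg] at heg
    linear_combination (norm := noncomm_ring) -heg
  have hqe : q * e = e := by simpa [he.1, hq.1] using congrArg star heq
  obtain ⟨y, hy⟩ : ∃ y, y = c + H * q := ⟨_, rfl⟩
  have hgc : g * c = 0 := by rw [hg, sub_mul, one_mul, hqc, sub_self]
  have hyy : (H * H - (c - g) * (c - g)) * q = y - y * y := by
    have h1 : y * y = c * c + c + H * H * q := by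
      rw [hy]
      linear_combination (norm := noncomm_ring) H * H * hq.2 - H * hHc q * q + H * hqc -
        hHc c * q + H * hcq + hH2 * c
    have h2 : (H * H - (c - g) * (c - g)) * q = H * H * q - c * c := by
      linear_combination (norm := noncomm_ring) hgc * q + c * hgq - g * hgq - c * hcq
    have h3 : H * q = H * H * q + H * H * q := by
      linear_combination (norm := noncomm_ring) -H * hH2 * q
    rw [h1, h2, hy]
    linear_combination (norm := noncomm_ring) -h3
  have hey : e - y = G * (y - y * y) := by
    rw [← hyy, ← mul_assoc, ← heG, hy]
    linear_combination (norm := noncomm_ring) hcq - heq - hgq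
  have hyx : ‖y - x‖ ≤ η := by
    refine le_trans (le_of_eq ?_) hca
    rw [hy]; congr 1; abel
  have hy2 : ‖y‖ ≤ 2 := by
    calc ‖y‖ = ‖(y - x) + x‖ := by rw [sub_add_cancel]
      _ ≤ ‖y - x‖ + ‖x‖ := norm_add_le _ _
      _ ≤ 2 := by linarith
  refine ⟨e, he, hqe, fun τ hτ ↦ ?_⟩
  rw [← hg]
  obtain ⟨γ, hγ⟩ : ∃ γ, γ = traceSeminorm τ (g * p) := ⟨_, rfl⟩
  rw [← hγ]
  have hpg : traceSeminorm τ (p * g) = γ := by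
    rw [hγ, ← hτ.traceSeminorm_star, star_mul, hp.1, hgp.1]
  have mul_left : ∀ (z w : A) (C : ℝ), ‖z‖ ≤ C →
      traceSeminorm τ (z * w) ≤ C * traceSeminorm τ w := fun z w C h ↦
    (hτ.traceSeminorm_mul_le z w).trans (by gcongr; exact traceSeminorm_nonneg τ w)
  have mul_right : ∀ (z w : A) (C : ℝ), ‖w‖ ≤ C →
      traceSeminorm τ (z * w) ≤ traceSeminorm τ z * C := fun z w C h ↦
    (hτ.traceSeminorm_mul_le' z w).trans (by gcongr; exact traceSeminorm_nonneg τ z)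
  have hxp : traceSeminorm τ (p - x) ≤ 2 * γ := by
    have h : p - x = p * g + g * p * q := by
      rw [hx, hg]; noncomm_ring
    have h1 := mul_right (g * p) q 1 hq1
    have h2 := hτ.traceSeminorm_add_le (p * g) (g * p * q)
    rw [← hγ] at h1
    rw [h]
    linarith
  have hyxτ : traceSeminorm τ (y - x) ≤ η := (hτ.traceSeminorm_le_norm _).trans hyx
  have hyyτ : traceSeminorm τ (y - y * y) ≤ 6 * γ + 4 * η := by
    have h : y - y * y = (y - x) - (p - x) - (y - x) * y - x * (y - x) +
        x * (p - x) + (p - x) * p := by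
      linear_combination (norm := noncomm_ring) -hp.2
    have b1 := mul_right (y - x) y 2 hy2
    have b2 := mul_left x (y - x) 1 hx1
    have b3 := mul_left x (p - x) 1 hx1
    have b4 := mul_right (p - x) p 1 hp1
    have t1 := hτ.traceSeminorm_sub_le (y - x) (p - x)
    have t2 := hτ.traceSeminorm_sub_le (y - x - (p - x)) ((y - x) * y)
    have t3 := hτ.traceSeminorm_sub_le (y - x - (p - x) - (y - x) * y) (x * (y - x))
    have t4 := hτ.traceSeminorm_add_le (y - x - (p - x) - (y - x) * y - x * (y - x))
      (x * (p - x))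
    have t5 := hτ.traceSeminorm_add_le (y - x - (p - x) - (y - x) * y - x * (y - x) +
      x * (p - x)) ((p - x) * p)
    rw [h]
    linarith
  have b1 := mul_left G (y - y * y) 2 hG
  rw [← hey] at b1
  have t1 := hτ.traceSeminorm_add_le (e - y) (y - x)
  have t2 := hτ.traceSeminorm_sub_le (e - y + (y - x)) (p - x)
  have h : e - p = e - y + (y - x) - (p - x) := by abel
  rw [h]
  linarith

end Approximation

/-- For every `ε > 0` and `n ∈ ℕ` there is `δ > 0` such that: if `A` is a
unital C*-algebra with real rank zero, `T` is a set of tracial states on `A`, `r ∈ A` is a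
projection, and `p₁, …, pₙ ≤ r` are projections with `‖pⱼ pₖ‖_{2,τ} < δ` for `j ≠ k` and all
`τ ∈ T`, then there are mutually orthogonal projections `q₁, …, qₙ ≤ r` with
`‖qₖ − pₖ‖_{2,τ} < ε` for all `k` and all `τ ∈ T`. -/
theorem exists_orthogonal_projections_close (ε : ℝ) (hε : 0 < ε) (n : ℕ) :
    ∃ δ > (0 : ℝ), ∀ (A : Type*) [CStarAlgebra A] [PartialOrder A] [StarOrderedRing A],
      RealRankZero A → ∀ (T : Set (A →ₗ[ℂ] ℂ)), (∀ τ ∈ T, IsTracialState τ) →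
      ∀ (r : A) (p : Fin n → A), IsProjection r → (∀ k, IsProjection (p k)) →
      (∀ k, p k ≤ r) →
      (∀ j k, j ≠ k → ∀ τ ∈ T, traceSeminorm τ (p j * p k) < δ) →
      ∃ q : Fin n → A, (∀ k, IsProjection (q k)) ∧ (∀ j k, j ≠ k → q j * q k = 0) ∧
        (∀ k, q k ≤ r) ∧ ∀ k, ∀ τ ∈ T, traceSeminorm τ (q k - p k) < ε := by
  induction n generalizing ε with
  | zero =>
    exact ⟨1, one_pos, fun A _ _ _ _ T _ r p _ _ _ _ ↦
      ⟨p, fun k ↦ k.elim0, fun k ↦ k.elim0, fun k ↦ k.elim0, fun k ↦ k.elim0⟩⟩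
  | succ n ih =>
    obtain ⟨ε', hε'⟩ : ∃ ε', ε' = ε / (56 * (n + 1)) := ⟨_, rfl⟩
    have hn : (0 : ℝ) < 56 * (n + 1) := by positivity
    have hmul : ε' * (56 * (n + 1)) = ε := by rw [hε', div_mul_cancel₀ _ hn.ne']
    have hpos : 0 < ε' := hε' ▸ div_pos hε hn
    have hnε : 0 ≤ ε' * n := by positivity
    obtain ⟨δ, hδ, H⟩ := ih ε' hpos
    refine ⟨min δ ε', lt_min hδ hpos, fun A _ _ _ hA T hT r p hr hp hpr hpp ↦ ?_⟩
    obtain ⟨q, hq, hqq, hqr, hqp⟩ := H A hA T hT r (fun k ↦ p k.succ) hr (fun k ↦ hp _)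
      (fun k ↦ hpr _) fun j k hjk τ hτ ↦
        (hpp _ _ (by simpa using hjk) τ hτ).trans_le (min_le_left _ _)
    have hrq : ∀ k, r * q k = q k := fun k ↦ (hq k).mul_eq_of_le hr (hqr k)
    obtain ⟨hQ, hrQ, hQq⟩ := hr.sub_sum hq hqq hrq
    have hη : 0 < min 1 (ε / 36) := by positivity
    obtain ⟨e, he, hQe, hep⟩ := hA.exists_projection_mul_eq (hp 0) hQ hη (min_le_left _ _)
    have hqe : ∀ k, q k * e = 0 := fun k ↦ by
      have h : q k * (r - ∑ j, q j) = 0 := by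
        simpa only [star_mul, hQ.1, (hq k).1, star_zero] using congrArg star (hQq k)
      rw [← hQe, ← mul_assoc, h, zero_mul]
    have heq : ∀ k, e * q k = 0 := fun k ↦ by
      simpa only [star_mul, he.1, (hq k).1, star_zero] using congrArg star (hqe k)
    refine ⟨Fin.cons e q, ?_, ?_, ?_, ?_⟩
    · exact Fin.cases he hq
    · refine Fin.cases (Fin.cases (fun h ↦ absurd rfl h) fun k _ ↦ heq k)
        fun j ↦ Fin.cases (fun _ ↦ hqe j) fun k h ↦ hqq j k fun hjk ↦ h (hjk ▸ rfl)
    · exact Fin.cases (he.le_of_mul_eq hr (by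
        rw [← hQe, ← mul_assoc, hrQ])) hqr
    · refine Fin.cases (fun τ hτ ↦ ?_) fun k τ hτ ↦ (hqp k τ hτ).trans_le ?_
      · change traceSeminorm τ (e - p 0) < ε
        have hτ' := hT τ hτ
        have h0 : (1 - (r - ∑ k, q k)) * p 0 = ∑ k, q k * p 0 := by
          rw [← Finset.sum_mul]
          linear_combination (norm := noncomm_ring) -(hp 0).mul_eq_of_le hr (hpr 0)
        have h1 : ∀ k, traceSeminorm τ (q k * p 0) ≤ 2 * ε' := fun k ↦ by
          have t := hτ'.traceSeminorm_add_le ((q k - p k.succ) * p 0) (p k.succ * p 0)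
          rw [← add_mul, sub_add_cancel] at t
          have t1 : traceSeminorm τ ((q k - p k.succ) * p 0) ≤ ε' * 1 :=
            (hτ'.traceSeminorm_mul_le' _ _).trans
              (mul_le_mul (hqp k τ hτ).le (hp 0).norm_le_one (norm_nonneg _) hpos.le)
          have t2 := (hpp k.succ 0 (Fin.succ_ne_zero k) τ hτ).trans_le (min_le_right _ _)
          linarith
        have h2 : traceSeminorm τ ((1 - (r - ∑ k, q k)) * p 0) ≤ n * (2 * ε') := by
          rw [h0]
          refine (hτ'.traceSeminorm_sum_le _ _).trans ((Finset.sum_le_sum fun k _ ↦ h1 k).trans ?_)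
          simp
        have h3 := hep τ hτ'
        have h4 := min_le_right (1 : ℝ) (ε / 36)
        nlinarith
      · nlinarith
end

section
/- For every ε > 0 and every n ∈ ℕ there is δ > 0 with the following property. Let A be a unital C*-algebra with real rank zero, let T be a set of tracial states on A, and let e₁, e₂, …, eₙ ∈ A be projections with Σ_{k=1}^n eₖ = 1. If p ∈ A is a projection such that ‖p eₖ − eₖ p‖_{2,τ} < δ for 1 ≤ k ≤ n and all τ ∈ T, then there is a projection q ∈ A which commutes with every eₖ and satisfies ‖q − p‖_{2,τ} < ε for all τ ∈ T. -/
open ComplexOrder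

section Projections

variable {A : Type*} [CStarAlgebra A]

theorem IsProjection.norm_le_one_s9 {e : A} (he : IsProjection e) : ‖e‖ ≤ 1 := by
  have h : ‖e‖ * ‖e‖ = ‖e‖ := by
    rw [← CStarRing.norm_star_mul_self (x := e), he.1, he.2]
  nlinarith [norm_nonneg e, sq_nonneg (‖e‖ - 1)]

theorem IsProjection.one_sub_s9 {e : A} (he : IsProjection e) : IsProjection (1 - e) := by
  refine ⟨by simp [he.1], ?_⟩
  rw [mul_sub, sub_mul, sub_mul, he.2]
  simp

theorem IsProjection.norm_mul_le {e : A} (he : IsProjection e) (x : A) : ‖e * x‖ ≤ ‖x‖ :=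
  (_root_.norm_mul_le e x).trans (mul_le_of_le_one_left (norm_nonneg x) he.norm_le_one_s9)

theorem IsProjection.mul_norm_le {e : A} (he : IsProjection e) (x : A) : ‖x * e‖ ≤ ‖x‖ :=
  (_root_.norm_mul_le x e).trans (mul_le_of_le_one_right (norm_nonneg x) he.norm_le_one_s9)

/-- Projections summing to one are pairwise orthogonal. -/
theorem IsProjection.mul_eq_zero_of_sum_eq_one [PartialOrder A] [StarOrderedRing A]
    {ι : Type*} [Fintype ι] {e : ι → A} (he : ∀ k, IsProjection (e k)) (hsum : ∑ k, e k = 1)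
    {i j : ι} (hij : i ≠ j) : e i * e j = 0 := by
  classical
  have hterm : ∀ k, star (e k * e j) * (e k * e j) = e j * e k * e j := fun k => by
    rw [star_mul, (he k).1, (he j).1, mul_assoc, ← mul_assoc (e k), (he k).2, mul_assoc]
  have h1 : ∑ k, e j * e k * e j = e j := by
    rw [← Finset.sum_mul, ← Finset.mul_sum, hsum, mul_one, (he j).2]
  rw [← Finset.add_sum_erase _ _ (Finset.mem_univ j), (he j).2, (he j).2] at h1
  have h2 : ∑ k ∈ Finset.univ.erase j, e j * e k * e j = 0 := by simpa using h1
  rw [Finset.sum_eq_zero_iff_of_nonneg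
    (fun k _ => by rw [← hterm]; exact star_mul_self_nonneg _)] at h2
  have h3 := h2 i (Finset.mem_erase.2 ⟨hij, Finset.mem_univ i⟩)
  rwa [← hterm, CStarRing.star_mul_self_eq_zero_iff] at h3

/-- The Schur complement of an invertible self-adjoint element with respect to a corner,
extended by the complementary projection, is invertible. -/
theorem schur_complement_mul_inverse {R : Type*} [Ring R] {e f c d g : R} (hee : e * e = e)
    (hff : f * f = f) (hef : e * f = 0) (hfe : f * e = 0) (hadd : e + f = 1)
    (hcd : c * d = 1) (hg : f * g * f * c * f = f) :
    (e * c * e - e * c * f * g * f * c * e + f) * (e * d * e + f) = 1 := by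
  have hed : e * d = d - f * d := by rw [eq_sub_iff_add_eq, ← add_mul, hadd, one_mul]
  have h1 : e * c * e * d * e = e - e * c * f * d * e := by
    calc e * c * e * d * e = e * c * (e * d) * e := by simp only [mul_assoc]
      _ = e * (c * d) * e - e * c * f * d * e := by rw [hed]; noncomm_ring
      _ = _ := by rw [hcd, mul_one, hee]
  have h2 : e * c * f * g * f * c * e * d * e = - (e * c * f * d * e) := by
    calc e * c * f * g * f * c * e * d * e = e * c * f * g * f * c * (e * d) * e := by
          simp only [mul_assoc]
      _ = e * c * f * g * f * (c * d) * e - e * c * (f * g * f * c * f) * d * e := by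
          rw [hed]; noncomm_ring
      _ = e * c * f * g * (f * e) - e * c * f * d * e := by
          rw [hcd, hg, mul_one, mul_assoc _ f e]
      _ = _ := by rw [hfe]; simp
  calc _ = e * c * (e * e) * d * e - e * c * f * g * f * c * (e * e) * d * e
        + (e * c * (e * f) - e * c * f * g * f * c * (e * f) + (f * e) * d * e + f * f) := by
          noncomm_ring
    _ = 1 := by
          rw [hee, hef, hfe, hff, h1, h2, ← hadd]
          noncomm_ring

/-- Real rank zero passes to corners. -/
theorem RealRankZero.exists_isUnit_commute (hA : RealRankZero A) {e x : A}
    (he : IsProjection e) (hx : IsSelfAdjoint x) {η : ℝ} (hη : 0 < η) :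
    ∃ b : A, IsSelfAdjoint b ∧ IsUnit b ∧ b * e = e * b ∧ ‖e * b - e * x * e‖ ≤ η := by
  obtain ⟨r, hr0, hr1, hr2⟩ : ∃ r : ℝ, 0 < r ∧ r ≤ 1 / 2 ∧ 2 * r ≤ η :=
    ⟨min (1 / 2) (η / 2), by positivity, min_le_left _ _, by
      have := min_le_right (1 / 2 : ℝ) (η / 2); linarith⟩
  obtain ⟨f, hf⟩ : ∃ f, f = 1 - e := ⟨_, rfl⟩
  have hfp : IsProjection f := hf ▸ he.one_sub_s9
  have hee := he.2
  have hff := hfp.2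
  have hef : e * f = 0 := by rw [hf, mul_sub, mul_one, hee, sub_self]
  have hfe : f * e = 0 := by rw [hf, sub_mul, one_mul, hee, sub_self]
  have hadd : e + f = 1 := by rw [hf]; abel
  have hy : IsSelfAdjoint (e * x * e + f) := by
    simp [IsSelfAdjoint, he.1, hfp.1, hx.star_eq, mul_assoc]
  obtain ⟨c, hc, hcu, hyc⟩ := hA _ hy r hr0
  obtain ⟨z, hz⟩ : ∃ z, z = e * x * e + f - c := ⟨_, rfl⟩
  have hcz : c = e * x * e + f - z := by rw [hz]; abel
  rw [← hz] at hyc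
  have hfcf : f * c * f = f - f * z * f := by
    rw [hcz]
    calc _ = (f * e) * x * e * f + f * f * f - f * z * f := by noncomm_ring
      _ = _ := by rw [hfe, hff, hff]; simp
  have hecf : e * c * f = - (e * z * f) := by
    rw [hcz]
    calc _ = e * e * x * (e * f) + (e * f) * f - e * z * f := by noncomm_ring
      _ = _ := by rw [hef]; simp
  have hece : e * c * e = e * x * e - e * z * e := by
    rw [hcz]
    calc _ = e * e * x * (e * e) + (e * f) * e - e * z * e := by noncomm_ring
      _ = _ := by rw [hef, hee]; simp
  have hfzf : ‖f * z * f‖ ≤ r := ((hfp.mul_norm_le _).trans (hfp.norm_mul_le _)).trans hyc.le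
  have heze : ‖e * z * e‖ ≤ r := ((he.mul_norm_le _).trans (he.norm_mul_le _)).trans hyc.le
  have hezf : ‖e * z * f‖ ≤ r := ((hfp.mul_norm_le _).trans (he.norm_mul_le _)).trans hyc.le
  have hγ : IsUnit (e + f * c * f) := by
    have : e + f * c * f = 1 - f * z * f := by rw [hfcf, ← hadd]; abel
    rw [this]
    exact isUnit_one_sub_of_norm_lt_one (by linarith)
  obtain ⟨u, hu⟩ := hγ
  have hγsa : IsSelfAdjoint (e + f * c * f) := by
    simp [IsSelfAdjoint, he.1, hfp.1, hc.star_eq, mul_assoc]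
  obtain ⟨g, hgu⟩ : ∃ g, g = (↑u⁻¹ : A) := ⟨_, rfl⟩
  have hg1 : g * (e + f * c * f) = 1 := by rw [← hu, hgu, Units.inv_mul]
  have hg2 : (e + f * c * f) * g = 1 := by rw [← hu, hgu, Units.mul_inv]
  have hgsa : star g = g := by
    have h1 : star g * (e + f * c * f) = 1 := by
      have := congrArg star hg2
      rwa [star_mul, hγsa.star_eq, star_one] at this
    exact left_inv_eq_right_inv h1 hg2
  have hgnorm : ‖g‖ ≤ 2 := by
    have h1 : g = 1 + g * (f * z * f) := by
      have h2 : e + f * c * f = 1 - f * z * f := by rw [hfcf, ← hadd]; abel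
      rw [h2, mul_sub, mul_one] at hg1
      rw [← hg1]; abel
    have hone : ‖(1 : A)‖ ≤ 1 := IsProjection.norm_le_one_s9 ⟨star_one _, mul_one _⟩
    have h3 : ‖g‖ ≤ ‖(1 : A)‖ + ‖g‖ * ‖f * z * f‖ := by
      conv_lhs => rw [h1]
      exact (norm_add_le _ _).trans (by gcongr; exact norm_mul_le _ _)
    nlinarith [norm_nonneg g]
  have hG : f * g * f * c * f = f := by
    calc f * g * f * c * f = f * g * ((e + f * c * f) * f) := by
          rw [add_mul, hef, zero_add, mul_assoc (f * c), hff]; simp only [mul_assoc]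
      _ = f * (g * (e + f * c * f)) * f := by simp only [mul_assoc]
      _ = f := by rw [hg1, mul_one, hff]
  obtain ⟨v, hv⟩ := hcu
  have hcd : c * (↑v⁻¹ : A) = 1 := by rw [← hv, Units.mul_inv]
  have hdsa : star (↑v⁻¹ : A) = ↑v⁻¹ := by
    have h1 : star (↑v⁻¹ : A) * c = 1 := by
      have := congrArg star hcd
      rwa [star_mul, hc.star_eq, star_one] at this
    exact left_inv_eq_right_inv h1 hcd
  have hinv := schur_complement_mul_inverse hee hff hef hfe hadd hcd hG
  have hbsa : IsSelfAdjoint (e * c * e - e * c * f * g * f * c * e + f) := by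
    simp [IsSelfAdjoint, he.1, hfp.1, hc.star_eq, hgsa, mul_assoc]
  have hinv' : (e * (↑v⁻¹ : A) * e + f) * (e * c * e - e * c * f * g * f * c * e + f) = 1 := by
    have h1 := congrArg star hinv
    rw [star_mul, hbsa.star_eq, star_one] at h1
    simpa [he.1, hfp.1, hdsa, mul_assoc] using h1
  have heb : e * (e * c * e - e * c * f * g * f * c * e + f)
      = e * c * e - e * c * f * g * f * c * e := by
    calc _ = e * e * c * e - e * e * c * f * g * f * c * e + e * f := by noncomm_ring
      _ = _ := by rw [hee, hef, add_zero]
  refine ⟨_, hbsa, ⟨⟨_, _, hinv, hinv'⟩, rfl⟩, ?_, ?_⟩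
  · rw [heb]
    calc _ = e * c * (e * e) - e * c * f * g * f * c * (e * e) + f * e := by noncomm_ring
      _ = _ := by rw [hee, hfe, add_zero]
  · have hfce : ‖f * c * e‖ ≤ r := by
      have h1 : star (e * c * f) = f * c * e := by
        simp [he.1, hfp.1, hc.star_eq, mul_assoc]
      rw [← h1, norm_star, hecf, norm_neg]
      exact hezf
    have h2 : e * (e * c * e - e * c * f * g * f * c * e + f) - e * x * e
        = - (e * z * e) - (e * c * f) * g * (f * c * e) := by
      rw [heb, hece]
      calc _ = - (e * z * e) - e * c * f * g * f * c * e := by noncomm_ring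
        _ = _ := by simp only [mul_assoc]
    rw [h2]
    have h3 : ‖(e * c * f) * g * (f * c * e)‖ ≤ r * 2 * r := by
      refine (norm_mul_le _ _).trans ?_
      gcongr
      refine (norm_mul_le _ _).trans ?_
      gcongr
      rw [hecf, norm_neg]
      exact hezf
    calc _ ≤ ‖-(e * z * e)‖ + ‖(e * c * f) * g * (f * c * e)‖ := norm_sub_le _ _
      _ ≤ r + r * 2 * r := by rw [norm_neg]; gcongr
      _ ≤ η := by nlinarith

/-- In real rank zero, a self-adjoint element that is block diagonal with respect to a partition
of unity into projections can be approximated by invertible ones. -/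
theorem RealRankZero.exists_isUnit_commute_partition [PartialOrder A] [StarOrderedRing A]
    (hA : RealRankZero A) {ι : Type*} [Fintype ι] {e : ι → A} (he : ∀ k, IsProjection (e k))
    (hsum : ∑ k, e k = 1) {x : A} (hx : IsSelfAdjoint x) {η : ℝ} (hη : 0 < η) :
    ∃ c : A, IsSelfAdjoint c ∧ IsUnit c ∧ (∀ k, c * e k = e k * c) ∧
      ‖c - ∑ k, e k * x * e k‖ ≤ η := by
  classical
  have hη' : 0 < η / (Fintype.card ι + 1) := by positivity
  choose b hbsa hbu hbc hbn using fun k => hA.exists_isUnit_commute (he k) hx hη'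
  choose u hu using hbu
  have horth : ∀ i j, i ≠ j → e i * e j = 0 := fun i j hij =>
    IsProjection.mul_eq_zero_of_sum_eq_one he hsum hij
  have hinvc : ∀ k, (↑(u k)⁻¹ : A) * e k = e k * ↑(u k)⁻¹ := fun k => by
    have h : Commute (↑(u k) : A) (e k) := by rw [hu]; exact hbc k
    exact h.units_inv_left
  have hprod : ∀ y z : ι → A, (∀ k, y k * e k = e k * y k) → (∀ k, y k * z k = 1) →
      (∑ k, e k * y k) * (∑ k, e k * z k) = 1 := fun y z hy hyz => by
    rw [Finset.sum_mul, ← hsum]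
    refine Finset.sum_congr rfl fun i _ => ?_
    rw [Finset.mul_sum, Finset.sum_eq_single i]
    · rw [mul_assoc, ← mul_assoc (y i), hy, mul_assoc, hyz, mul_one, (he i).2]
    · intro j _ hj
      rw [← hy, mul_assoc, ← mul_assoc (e i), horth i j hj.symm, zero_mul, mul_zero]
    · simp
  refine ⟨∑ k, e k * b k, ?_, ?_, fun k => ?_, ?_⟩
  · rw [IsSelfAdjoint, star_sum]
    refine Finset.sum_congr rfl fun k _ => ?_
    rw [star_mul, (hbsa k).star_eq, (he k).1, hbc]
  · refine ⟨⟨_, ∑ k, e k * ↑(u k)⁻¹, hprod b (fun k => ↑(u k)⁻¹) hbc fun k => ?_,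
      hprod (fun k => ↑(u k)⁻¹) b hinvc fun k => ?_⟩, rfl⟩
    · rw [← hu, Units.mul_inv]
    · rw [← hu, Units.inv_mul]
  · rw [Finset.sum_mul, Finset.mul_sum]
    refine Finset.sum_congr rfl fun i _ => ?_
    by_cases h : i = k
    · subst h
      rw [mul_assoc, hbc]
    · rw [← hbc, mul_assoc, horth i k h, hbc, ← mul_assoc, horth k i (Ne.symm h)]
      simp
  · rw [← Finset.sum_sub_distrib]
    calc _ ≤ ∑ _k : ι, η / (Fintype.card ι + 1) := norm_sum_le_of_le _ fun k _ => hbn k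
      _ = Fintype.card ι * (η / (Fintype.card ι + 1)) := by simp
      _ ≤ η := by
        rw [mul_div_assoc', div_le_iff₀ (by positivity)]
        nlinarith

/-- The spectral projection of an invertible self-adjoint element `c` on the positive half-line
is close to `c + 1/2` as soon as `c ^ 2` is close to `1/4`. -/
theorem exists_isProjection_of_isUnit [PartialOrder A] [StarOrderedRing A] {c : A}
    (hc : IsSelfAdjoint c) (hcu : IsUnit c) :
    ∃ q : A, IsProjection q ∧ (∀ x, c * x = x * c → q * x = x * q) ∧
      star (q - c - algebraMap ℝ A (1 / 2)) * (q - c - algebraMap ℝ A (1 / 2)) ≤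
        (4 : ℝ) • (star (algebraMap ℝ A (1 / 4) - c * c) * (algebraMap ℝ A (1 / 4) - c * c)) := by
  have h0 : (0 : ℝ) ∉ spectrum ℝ c := by rwa [spectrum.zero_notMem_iff]
  have hcont : ContinuousOn (fun t : ℝ => if 0 < t then (1 : ℝ) else 0) (spectrum ℝ c) := by
    intro t ht
    have ht0 : t ≠ 0 := fun h => h0 (h ▸ ht)
    refine ContinuousAt.continuousWithinAt ?_
    rcases lt_or_gt_of_ne ht0 with h | h
    · refine (continuousAt_const (y := (0 : ℝ))).congr ?_
      filter_upwards [Iio_mem_nhds h] with s hs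
      rw [if_neg (not_lt.2 (le_of_lt hs))]
    · refine (continuousAt_const (y := (1 : ℝ))).congr ?_
      filter_upwards [Ioi_mem_nhds h] with s hs
      rw [if_pos (Set.mem_Ioi.1 hs)]
  have hqsa : IsSelfAdjoint (cfc (fun t : ℝ => if 0 < t then (1 : ℝ) else 0) c) :=
    cfc_predicate _ _
  refine ⟨cfc (fun t : ℝ => if 0 < t then (1 : ℝ) else 0) c, ⟨hqsa, ?_⟩, fun x hx => ?_, ?_⟩
  · rw [← cfc_mul _ _ c hcont hcont]
    congr 1
    ext t
    split_ifs <;> simp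
  · exact ((show Commute c x from hx).cfc_real _)
  · have h1 : cfc (fun t : ℝ => if 0 < t then (1 : ℝ) else 0) c - c - algebraMap ℝ A (1 / 2)
        = cfc (fun t : ℝ => (if 0 < t then (1 : ℝ) else 0) - t - 1 / 2) c := by
      rw [cfc_sub (fun t : ℝ => (if 0 < t then (1 : ℝ) else 0) - t) (fun _ => 1 / 2) c
          (hcont.sub continuousOn_id) continuousOn_const,
        cfc_sub (fun t : ℝ => if 0 < t then (1 : ℝ) else 0) (fun t => t) c hcont continuousOn_id,
        cfc_const _ c, cfc_id' ℝ c]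
    have h2 : algebraMap ℝ A (1 / 4) - c * c = cfc (fun t : ℝ => 1 / 4 - t * t) c := by
      rw [cfc_sub (fun _ : ℝ => 1 / 4) (fun t => t * t) c continuousOn_const (by fun_prop),
        cfc_const _ c, cfc_mul (fun t : ℝ => t) (fun t => t) c continuousOn_id continuousOn_id,
        cfc_id' ℝ c]
    have hc1 : ContinuousOn (fun t : ℝ => (if 0 < t then (1 : ℝ) else 0) - t - 1 / 2)
        (spectrum ℝ c) := (hcont.sub continuousOn_id).sub continuousOn_const
    have hc2 : ContinuousOn (fun t : ℝ => 1 / 4 - t * t) (spectrum ℝ c) := by fun_prop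
    have hs : ∀ φ : ℝ → ℝ, star (cfc φ c) = cfc φ c := fun φ =>
      (cfc_predicate φ c : IsSelfAdjoint (cfc φ c)).star_eq
    rw [h1, h2, hs, hs, ← cfc_mul _ _ c hc1 hc1, ← cfc_mul _ _ c hc2 hc2,
      ← cfc_smul (4 : ℝ) (fun t : ℝ => (1 / 4 - t * t) * (1 / 4 - t * t)) c (hc2.mul hc2)]
    refine cfc_mono (fun t _ => ?_) (hc1.mul hc1) (by fun_prop)
    simp only [smul_eq_mul]
    split_ifs with h
    · have h3 : 4 * ((1 / 4 - t * t) * (1 / 4 - t * t)) - (1 - t - 1 / 2) * (1 - t - 1 / 2)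
          = (1 / 2 - t) ^ 2 * (4 * t * (1 + t)) := by ring
      have : 0 ≤ (1 / 2 - t) ^ 2 * (4 * t * (1 + t)) := by positivity
      linarith
    · have h3 : 4 * ((1 / 4 - t * t) * (1 / 4 - t * t)) - (0 - t - 1 / 2) * (0 - t - 1 / 2)
          = (1 / 2 + t) ^ 2 * (4 * (-t) * (1 + -t)) := by ring
      have h4 : 0 ≤ -t := by linarith
      have : 0 ≤ (1 / 2 + t) ^ 2 * (4 * (-t) * (1 + -t)) := by positivity
      linarith

end Projections

section TraceSeminorm

theorem re_map_real_smul {A : Type*} [CStarAlgebra A] (τ : A →ₗ[ℂ] ℂ) (r : ℝ) (a : A) :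
    (τ (r • a)).re = r * (τ a).re := by
  rw [← Complex.coe_smul r a, map_smul, smul_eq_mul, Complex.re_ofReal_mul]

variable {A : Type*} [CStarAlgebra A] [PartialOrder A] {τ : A →ₗ[ℂ] ℂ}

theorem IsTracialState.re_nonneg (hτ : IsTracialState τ) {a : A} (ha : 0 ≤ a) : 0 ≤ (τ a).re :=
  (Complex.le_def.1 (hτ.2.1 a ha)).1

theorem IsTracialState.re_star_eq (hτ : IsTracialState τ) (x : A) :
    (τ (star (star x) * star x)).re = (τ (star x * x)).re := by
  rw [star_star, hτ.2.2]

variable [StarOrderedRing A]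

theorem IsTracialState.re_mono (hτ : IsTracialState τ) {a b : A} (hab : a ≤ b) :
    (τ a).re ≤ (τ b).re := by
  have := hτ.re_nonneg (sub_nonneg.2 hab)
  rw [map_sub, Complex.sub_re] at this
  linarith

theorem IsTracialState.re_star_mul_self_nonneg (hτ : IsTracialState τ) (x : A) :
    0 ≤ (τ (star x * x)).re := hτ.re_nonneg (star_mul_self_nonneg x)

theorem IsTracialState.re_add_le (hτ : IsTracialState τ) (x y : A) :
    (τ (star (x + y) * (x + y))).re ≤ 2 * (τ (star x * x)).re + 2 * (τ (star y * y)).re := by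
  have h1 := hτ.re_star_mul_self_nonneg (x - y)
  have h2 : star (x + y) * (x + y) + star (x - y) * (x - y)
      = star x * x + star x * x + (star y * y + star y * y) := by
    rw [star_add, star_sub]; noncomm_ring
  have h3 := congrArg (fun z => (τ z).re) h2
  simp only [map_add, Complex.add_re] at h3
  linarith

theorem IsTracialState.re_sub_le (hτ : IsTracialState τ) (x y : A) :
    (τ (star (x - y) * (x - y))).re ≤ 2 * (τ (star x * x)).re + 2 * (τ (star y * y)).re := by
  rw [sub_eq_add_neg]
  simpa using hτ.re_add_le x (-y)

theorem IsTracialState.re_mul_le (hτ : IsTracialState τ) (x y : A) :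
    (τ (star (x * y) * (x * y))).re ≤ ‖x‖ ^ 2 * (τ (star y * y)).re := by
  have h1 : star (x * y) * (x * y) = star y * (star x * x) * y := by
    rw [star_mul]; noncomm_ring
  have h2 : star y * (star x * x) * y ≤ (‖x‖ ^ 2) • (star y * y) := by
    have h3 := CStarAlgebra.star_left_conjugate_le_norm_smul (a := y) (b := star x * x)
      (IsSelfAdjoint.star_mul_self x)
    rwa [CStarRing.norm_star_mul_self, ← pow_two] at h3
  rw [h1]
  refine (hτ.re_mono h2).trans_eq (re_map_real_smul _ _ _)

theorem IsTracialState.re_le_norm (hτ : IsTracialState τ) (x : A) :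
    (τ (star x * x)).re ≤ ‖x‖ ^ 2 := by
  simpa [hτ.1] using hτ.re_mul_le x 1

theorem IsTracialState.re_sum_le (hτ : IsTracialState τ) {ι : Type*} (s : Finset ι) (x : ι → A)
    {C : ℝ} (hC : 0 ≤ C) (hx : ∀ k ∈ s, (τ (star (x k) * x k)).re ≤ C) :
    (τ (star (∑ k ∈ s, x k) * ∑ k ∈ s, x k)).re ≤ 4 ^ s.card * C := by
  classical
  induction s using Finset.induction_on with
  | empty => simpa using hC
  | insert a s ha ih =>
    rw [Finset.sum_insert ha, Finset.card_insert_of_notMem ha, pow_succ]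
    have h1 := hτ.re_add_le (x a) (∑ k ∈ s, x k)
    have h2 := ih fun k hk => hx k (Finset.mem_insert_of_mem hk)
    have h3 := hx a (Finset.mem_insert_self a s)
    have h4 : (1 : ℝ) * C ≤ 4 ^ s.card * C := by
      gcongr
      exact one_le_pow₀ (by norm_num)
    linarith

/-- The block-diagonal compression of an almost commuting projection is close to it. -/
theorem IsTracialState.re_compression_sub_le (hτ : IsTracialState τ) {ι : Type*} [Fintype ι]
    {e : ι → A} (he : ∀ k, IsProjection (e k)) (hsum : ∑ k, e k = 1) {p : A} {C : ℝ}
    (hC : 0 ≤ C)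
    (hp : ∀ k, (τ (star (p * e k - e k * p) * (p * e k - e k * p))).re ≤ C) :
    (τ (star (∑ k, e k * p * e k - p) * (∑ k, e k * p * e k - p))).re
      ≤ 4 ^ Fintype.card ι * C := by
  have h1 : ∑ k, e k * p * e k - p = ∑ k, e k * (p * e k - e k * p) := by
    have h2 : ∑ k, e k * p = p := by rw [← Finset.sum_mul, hsum, one_mul]
    calc _ = ∑ k, e k * p * e k - ∑ k, e k * p := by rw [h2]
      _ = _ := by
        rw [← Finset.sum_sub_distrib]
        refine Finset.sum_congr rfl fun k _ => ?_
        rw [mul_sub, ← mul_assoc, ← mul_assoc, (he k).2]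
  rw [h1]
  refine hτ.re_sum_le _ _ hC fun k _ => ?_
  refine (hτ.re_mul_le _ _).trans ((mul_le_of_le_one_left (hτ.re_star_mul_self_nonneg _) ?_).trans
    (hp k))
  exact pow_le_one₀ (norm_nonneg _) (he k).norm_le_one_s9

theorem IsTracialState.re_sub_mul_self_le (hτ : IsTracialState τ) {a p : A}
    (hp : IsProjection p) (ha : IsSelfAdjoint a) {M : ℝ} (hM : ‖a‖ ≤ M) :
    (τ (star (a - a * a) * (a - a * a))).re
      ≤ (6 + 4 * M ^ 2) * (τ (star (a - p) * (a - p))).re := by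
  have hN := hτ.re_star_mul_self_nonneg (a - p)
  have h1 : a - a * a = (a - p) - (a * (a - p) + (a - p) * p) := by
    have : (a - p) - (a * (a - p) + (a - p) * p) = a - a * a + (p * p - p) := by noncomm_ring
    rw [this, hp.2, sub_self, add_zero]
  have h2 : star ((a - p) * p) = p * (a - p) := by
    rw [star_mul, star_sub, hp.1, ha.star_eq]
  have h3 : (τ (star ((a - p) * p) * ((a - p) * p))).re ≤ (τ (star (a - p) * (a - p))).re := by
    rw [← hτ.re_star_eq, h2]
    exact (hτ.re_mul_le _ _).trans
      (mul_le_of_le_one_left hN (pow_le_one₀ (norm_nonneg _) hp.norm_le_one_s9))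
  have h4 : (τ (star (a * (a - p)) * (a * (a - p)))).re
      ≤ M ^ 2 * (τ (star (a - p) * (a - p))).re :=
    (hτ.re_mul_le _ _).trans (by gcongr)
  have h5 := hτ.re_add_le (a * (a - p)) ((a - p) * p)
  have h6 := hτ.re_sub_le (a - p) (a * (a - p) + (a - p) * p)
  rw [← h1] at h6
  linarith

end TraceSeminorm

/-- For every `ε > 0` and `n ∈ ℕ` there is `δ > 0` such that: if `A` is a
unital C*-algebra with real rank zero, `T` is a set of tracial states on `A`,
`e₁, …, eₙ ∈ A` are projections with `Σ eₖ = 1`, and `p` is a projection which commutes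
with each `eₖ` up to `δ` in each `‖·‖_{2,τ}` for `τ ∈ T`, then there is a projection `q`
commuting with every `eₖ` with `‖q − p‖_{2,τ} < ε` for all `τ ∈ T`. -/
theorem exists_commuting_projection_partition (ε : ℝ) (hε : 0 < ε) (n : ℕ) :
    ∃ δ > (0 : ℝ), ∀ (A : Type*) [CStarAlgebra A] [PartialOrder A] [StarOrderedRing A],
      RealRankZero A → ∀ (T : Set (A →ₗ[ℂ] ℂ)), (∀ τ ∈ T, IsTracialState τ) →
      ∀ e : Fin n → A, (∀ k, IsProjection (e k)) → (∑ k, e k) = 1 →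
        ∀ p : A, IsProjection p →
        (∀ k, ∀ τ ∈ T, traceSeminorm τ (p * e k - e k * p) < δ) →
        ∃ q : A, IsProjection q ∧ (∀ k, q * e k = e k * q) ∧
          ∀ τ ∈ T, traceSeminorm τ (q - p) < ε := by
  obtain ⟨K, hK⟩ : ∃ K : ℝ, K = (4 + 16 * (6 + 4 * (n : ℝ) ^ 2)) * 4 ^ n := ⟨_, rfl⟩
  have hKpos : 0 < K := by rw [hK]; positivity
  refine ⟨Real.sqrt (ε ^ 2 / (2 * K)), by positivity, ?_⟩
  intro A _ _ _ hA T hT e he hsum p hp hcomm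
  obtain ⟨a, ha⟩ : ∃ a, a = ∑ k, e k * p * e k := ⟨_, rfl⟩
  have hasa : IsSelfAdjoint a := by
    rw [ha, IsSelfAdjoint, star_sum]
    refine Finset.sum_congr rfl fun k _ => ?_
    simp [(he k).1, hp.1, mul_assoc]
  have hanorm : ‖a‖ ≤ n := by
    rw [ha]
    refine (norm_sum_le_of_le (n := fun _ => (1 : ℝ)) _ fun k _ => ?_).trans_eq (by simp)
    exact (((he k).mul_norm_le _).trans ((he k).norm_mul_le _)).trans hp.norm_le_one_s9
  obtain ⟨L, hL⟩ : ∃ L : ℝ, L = 16 * (2 * (n + 1) + 1) ^ 2 + 4 := ⟨_, rfl⟩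
  have hLpos : 0 < L := by rw [hL]; positivity
  obtain ⟨η, hη0, hη1, hηL⟩ : ∃ η : ℝ, 0 < η ∧ η ≤ 1 ∧ L * η ^ 2 < ε ^ 2 / 2 := by
    refine ⟨min 1 (ε ^ 2 / (4 * L)), by positivity, min_le_left _ _, ?_⟩
    have h1 := min_le_left 1 (ε ^ 2 / (4 * L))
    have h2 := min_le_right 1 (ε ^ 2 / (4 * L))
    have h3 : 0 < min 1 (ε ^ 2 / (4 * L)) := by positivity
    rw [le_div_iff₀ (by positivity)] at h2
    have h4 : (min 1 (ε ^ 2 / (4 * L))) ^ 2 ≤ min 1 (ε ^ 2 / (4 * L)) := by nlinarith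
    have h5 : 0 < ε ^ 2 := by positivity
    nlinarith
  have hxsa : IsSelfAdjoint (p - algebraMap ℝ A (1 / 2)) :=
    (show IsSelfAdjoint p from hp.1).sub (IsSelfAdjoint.algebraMap A (IsSelfAdjoint.all _))
  obtain ⟨c, hcsa, hcu, hce, hcn⟩ := hA.exists_isUnit_commute_partition he hsum hxsa hη0
  have hblock : ∑ k, e k * (p - algebraMap ℝ A (1 / 2)) * e k = a - algebraMap ℝ A (1 / 2) := by
    have h1 : ∑ k, e k * algebraMap ℝ A (1 / 2) * e k = algebraMap ℝ A (1 / 2) := by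
      calc _ = ∑ k, e k * algebraMap ℝ A (1 / 2) := by
            refine Finset.sum_congr rfl fun k _ => ?_
            rw [mul_assoc, Algebra.commutes (1 / 2 : ℝ) (e k), ← mul_assoc, (he k).2]
        _ = _ := by rw [← Finset.sum_mul, hsum, one_mul]
    simp only [mul_sub, sub_mul, Finset.sum_sub_distrib]
    rw [h1, ha]
  rw [hblock] at hcn
  obtain ⟨q, hq, hqc, hqle⟩ := exists_isProjection_of_isUnit hcsa hcu
  refine ⟨q, hq, fun k => hqc _ (hce k), fun τ hτT => ?_⟩
  have hτ := hT τ hτT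
  obtain ⟨h, hh⟩ : ∃ h, h = algebraMap ℝ A (1 / 2) := ⟨_, rfl⟩
  obtain ⟨d, hd⟩ : ∃ d, d = c - (a - h) := ⟨_, rfl⟩
  rw [← hh] at hcn hqle
  rw [← hd] at hcn
  have hhh : h * h = algebraMap ℝ A (1 / 4) := by rw [hh, ← map_mul]; norm_num
  have hh2 : h + h = 1 := by
    rw [hh, ← map_add]; norm_num
  have hhc : h * a = a * h := by rw [hh]; exact Algebra.commutes _ _
  have hcd : c = a - h + d := by rw [hd]; abel
  have hu : (τ (star (a - p) * (a - p))).re ≤ 4 ^ n * (ε ^ 2 / (2 * K)) := by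
    have := hτ.re_compression_sub_le he hsum (p := p) (C := ε ^ 2 / (2 * K)) (by positivity)
      fun k => (Real.sqrt_le_sqrt_iff (by positivity)).1 (hcomm k τ hτT).le
    simpa [ha] using this
  have hhnorm : ‖h‖ ≤ 1 := by
    rw [hh, norm_algebraMap]
    have hone : ‖(1 : A)‖ ≤ 1 := IsProjection.norm_le_one_s9 ⟨star_one _, mul_one _⟩
    rw [Real.norm_of_nonneg (by norm_num)]
    linarith
  have hc0 : ‖a - h‖ ≤ n + 1 := (norm_sub_le _ _).trans (by linarith)
  have hc1 : ‖c‖ ≤ n + 1 + 1 := by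
    rw [hcd]
    exact (norm_add_le _ _).trans (by linarith)
  have hsq : algebraMap ℝ A (1 / 4) - c * c = (a - a * a) - ((a - h) * d + d * c) := by
    have h1 : (a - h) * d + d * c = c * c - (a - h) * (a - h) := by rw [hd]; noncomm_ring
    have h2 : a * h + a * h = a := by rw [← mul_add, hh2, mul_one]
    have h3 : (a - h) * (a - h) = a * a - (a * h + a * h) + h * h := by
      calc _ = a * a - (a * h + h * a) + h * h := by noncomm_ring
        _ = _ := by rw [hhc]
    rw [h1, h3, h2, hhh]
    abel
  have hrem : (τ (star ((a - h) * d + d * c) * ((a - h) * d + d * c))).re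
      ≤ ((2 * (n + 1) + 1) * η) ^ 2 := by
    refine (hτ.re_le_norm _).trans ?_
    gcongr
    calc _ ≤ ‖a - h‖ * ‖d‖ + ‖d‖ * ‖c‖ :=
          (norm_add_le _ _).trans (add_le_add (norm_mul_le _ _) (norm_mul_le _ _))
      _ ≤ (n + 1) * η + η * (n + 1 + 1) := by gcongr
      _ = _ := by ring
  have hdef := hτ.re_sub_mul_self_le hp hasa hanorm
  have h1 := hτ.re_sub_le (a - a * a) ((a - h) * d + d * c)
  rw [← hsq] at h1
  have h2 := hτ.re_mono hqle
  rw [re_map_real_smul] at h2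
  have hdn : (τ (star d * d)).re ≤ η ^ 2 := (hτ.re_le_norm d).trans (by gcongr)
  have h3 := hτ.re_add_le d (a - p)
  have h4 := hτ.re_add_le (q - c - h) (d + (a - p))
  have h5 : q - c - h + (d + (a - p)) = q - p := by rw [hd]; abel
  rw [h5] at h4
  have hfin : (τ (star (q - p) * (q - p))).re < ε ^ 2 := by
    have h6 : (4 + 16 * (6 + 4 * (n : ℝ) ^ 2)) * (τ (star (a - p) * (a - p))).re ≤ ε ^ 2 / 2 := by
      calc _ ≤ (4 + 16 * (6 + 4 * (n : ℝ) ^ 2)) * (4 ^ n * (ε ^ 2 / (2 * K))) := by gcongr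
        _ = K * (ε ^ 2 / (2 * K)) := by rw [hK]; ring
        _ = ε ^ 2 / 2 := by field_simp
    have h7 : 16 * ((2 * (n + 1) + 1) * η) ^ 2 + 4 * η ^ 2 = L * η ^ 2 := by rw [hL]; ring
    linarith
  rw [traceSeminorm, Real.sqrt_lt' hε]
  exact hfin
end
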